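/- Let a, b, c be nonnegative integers with a ≥ b + c, let q be a prime power with q > a + 1, and let P be the integral triangle P = conv{(0,0),(a,0),(b,c)}. Then d(C_P(𝔽_q)) = (q−1)² − a(q−1). -/

import Mathlib

open Pointwise

/-- Embed a lattice point of `ℤ²` into `ℝ²`. -/
def toR2 (m : ℤ × ℤ) : ℝ × ℝ := ((m.1 : ℝ), (m.2 : ℝ))

/-- An integral convex polygon: the convex hull of a finite nonempty set of lattice points. -/
def IsIntPolygon (P : Set (ℝ × ℝ)) : Prop :=
  ∃ V : Finset (ℤ × ℤ), V.Nonempty ∧ P = convexHull ℝ (toR2 '' ↑V)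

/-- The lattice points of a subset of `ℝ²`. -/
def latticePts (P : Set (ℝ × ℝ)) : Set (ℤ × ℤ) := {m | toR2 m ∈ P}

/-- `I(P)`: the number of lattice points in the interior of `P`. -/
noncomputable def intPts (P : Set (ℝ × ℝ)) : ℕ := (latticePts (interior P)).ncard

/-- `#(P)`: the number of lattice points of `P`. -/
noncomputable def numPts (P : Set (ℝ × ℝ)) : ℕ := (latticePts P).ncard

/-- The lattice points of the square `□_{q-1} = [0, q-2] × [0, q-2]`. -/
def box (q : ℕ) : Set (ℤ × ℤ) :=
  {m | 0 ≤ m.1 ∧ m.1 ≤ (q : ℤ) - 2 ∧ 0 ≤ m.2 ∧ m.2 ≤ (q : ℤ) - 2}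

/-- The evaluation vector of the monomial `x^{m₁} y^{m₂}` at all points of the torus `(F*)²`. -/
def evalVec (F : Type) [Field F] (m : ℤ × ℤ) : Fˣ × Fˣ → F :=
  fun p => ((p.1 ^ m.1 * p.2 ^ m.2 : Fˣ) : F)

/-- The toric code associated to a set `S ⊆ ℤ²` of exponent vectors: the span of the
evaluation vectors of the corresponding monomials. -/
noncomputable def toricCode (F : Type) [Field F] (S : Set (ℤ × ℤ)) :
    Submodule F (Fˣ × Fˣ → F) :=
  Submodule.span F (evalVec F '' S)

/-- Hamming weight of a word indexed by the torus `(F*)²`. -/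
noncomputable def wt {F : Type} [Field F] (c : Fˣ × Fˣ → F) : ℕ :=
  {p | c p ≠ 0}.ncard

/-- Minimum distance of a linear code: minimum Hamming weight of a nonzero codeword. -/
noncomputable def minDist (F : Type) [Field F] (C : Submodule F (Fˣ × Fˣ → F)) : ℕ :=
  sInf {w | ∃ c ∈ C, c ≠ 0 ∧ wt c = w}

/-- The support of a bivariate polynomial, as a set of lattice points. -/
def suppZ {K : Type} [CommSemiring K] (f : MvPolynomial (Fin 2) K) : Set (ℤ × ℤ) :=
  (fun d : Fin 2 →₀ ℕ => ((d 0 : ℤ), (d 1 : ℤ))) '' ↑f.support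

/-- The Newton polygon of a bivariate polynomial. -/
noncomputable def NP {K : Type} [CommSemiring K] (f : MvPolynomial (Fin 2) K) :
    Set (ℝ × ℝ) :=
  convexHull ℝ (toR2 '' suppZ f)

/-- Evaluate a bivariate polynomial at a point of the torus `(F*)²`. -/
noncomputable def evalT {F : Type} [Field F] (f : MvPolynomial (Fin 2) F) (p : Fˣ × Fˣ) : F :=
  MvPolynomial.eval ![(p.1 : F), (p.2 : F)] f

/-- The number of points of the torus `(F*)²` at which `f` vanishes. -/
noncomputable def nzeros {F : Type} [Field F] (f : MvPolynomial (Fin 2) F) : ℕ :=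
  {p : Fˣ × Fˣ | evalT f p = 0}.ncard

/-- Words of a toric code with exponents in the simplex of size `a` are values of polynomials of
total degree at most `a`. -/
theorem exists_evalT_eq_of_mem_toricCode {F : Type} [Field F] {S : Set (ℤ × ℤ)} {a : ℕ}
    (hS : ∀ m ∈ S, 0 ≤ m.1 ∧ 0 ≤ m.2 ∧ m.1 + m.2 ≤ a) {w : Fˣ × Fˣ → F}
    (hw : w ∈ toricCode F S) :
    ∃ f : MvPolynomial (Fin 2) F, f.totalDegree ≤ a ∧ ∀ p, evalT f p = w p := by
  induction hw using Submodule.span_induction with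
  | mem w hw =>
    obtain ⟨⟨m, n⟩, hm, rfl⟩ := hw
    obtain ⟨h₁, h₂, h₃⟩ := hS _ hm
    lift m to ℕ using h₁
    lift n to ℕ using h₂
    refine ⟨MvPolynomial.X 0 ^ m * MvPolynomial.X 1 ^ n, ?_, fun p => ?_⟩
    · refine (MvPolynomial.totalDegree_mul _ _).trans ?_
      simp only [MvPolynomial.totalDegree_X_pow]
      dsimp only at h₃
      exact_mod_cast h₃
    · simp [evalT, evalVec]
  | zero => exact ⟨0, by simp, fun p => by simp [evalT]⟩
  | add u v _ _ hu hv =>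
    obtain ⟨f, hf, hfu⟩ := hu
    obtain ⟨g, hg, hgv⟩ := hv
    refine ⟨f + g, (MvPolynomial.totalDegree_add f g).trans (max_le hf hg), fun p => ?_⟩
    simp [← hfu, ← hgv, evalT]
  | smul r u _ hu =>
    obtain ⟨f, hf, hfu⟩ := hu
    refine ⟨r • f, (MvPolynomial.totalDegree_smul_le r f).trans hf, fun p => ?_⟩
    simp [← hfu, evalT]

/-- A nonzero bivariate polynomial of total degree `d` has at most `d (q - 1)` zeros in the
torus. -/
theorem nzeros_le_totalDegree_mul {F : Type} [Field F] [Fintype F]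
    {f : MvPolynomial (Fin 2) F} (hf : f ≠ 0) :
    nzeros f ≤ f.totalDegree * Nat.card Fˣ := by
  classical
  set S : Finset F := Finset.univ.image (fun u : Fˣ => (u : F)) with hS
  have hcard : S.card = Nat.card Fˣ := by
    rw [hS, Finset.card_image_of_injective _ Units.val_injective, Finset.card_univ,
      Nat.card_eq_fintype_card]
  have hpos : (0 : ℚ≥0) < Nat.card Fˣ := by exact_mod_cast Nat.card_pos
  have hsz := MvPolynomial.schwartz_zippel_totalDegree hf S
  rw [hcard, div_le_div_iff₀ (by positivity) hpos, pow_two, ← mul_assoc] at hsz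
  have hle := le_of_mul_le_mul_right hsz hpos
  refine le_trans ?_ (by exact_mod_cast hle)
  rw [nzeros, ← Set.ncard_coe_finset]
  refine Set.ncard_le_ncard_of_injOn (fun p : Fˣ × Fˣ => ![(p.1 : F), (p.2 : F)]) ?_ ?_
  · intro p hp
    have hp' : MvPolynomial.eval ![(p.1 : F), (p.2 : F)] f = 0 := hp
    simp [hp', hS, Fin.forall_fin_two]
  · intro p _ r _ h
    have h0 := congrFun h 0
    have h1 := congrFun h 1
    simp only [Matrix.cons_val_zero, Matrix.cons_val_one] at h0 h1
    exact Prod.ext (Units.ext h0) (Units.ext h1)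

/-- Every nonzero word of a toric code with exponents in the simplex of size `a` has weight at
least `(q - 1)² - a (q - 1)`. -/
theorem sq_le_wt_add_of_mem_toricCode {F : Type} [Field F] [Fintype F] {S : Set (ℤ × ℤ)} {a : ℕ}
    (hS : ∀ m ∈ S, 0 ≤ m.1 ∧ 0 ≤ m.2 ∧ m.1 + m.2 ≤ a) {w : Fˣ × Fˣ → F}
    (hw : w ∈ toricCode F S) (hw0 : w ≠ 0) :
    Nat.card Fˣ ^ 2 ≤ wt w + a * Nat.card Fˣ := by
  obtain ⟨f, hdeg, hfw⟩ := exists_evalT_eq_of_mem_toricCode hS hw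
  have hf : f ≠ 0 := by
    rintro rfl
    exact hw0 (funext fun p => by simp [← hfw, evalT])
  have hz := (nzeros_le_totalDegree_mul hf).trans (Nat.mul_le_mul_right _ hdeg)
  have hsum := Set.ncard_add_ncard_compl {p | w p ≠ 0}
  have hcompl : {p | w p ≠ 0}ᶜ = {p | evalT f p = 0} := by
    ext p
    simp [hfw]
  rw [hcompl, Nat.card_prod, ← pow_two] at hsum
  rw [← hsum]
  exact Nat.add_le_add_left hz _

/-- If the exponents contain the segment from `(0,0)` to `(a,0)`, the code has a word of weight
`(q - 1 - a)(q - 1)`. -/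
theorem exists_mem_toricCode_wt_eq {F : Type} [Field F] [Fintype F] {S : Set (ℤ × ℤ)} {a : ℕ}
    (hS : ∀ i : ℕ, i ≤ a → ((i : ℤ), (0 : ℤ)) ∈ S) (ha : a ≤ Nat.card Fˣ) :
    ∃ w ∈ toricCode F S, wt w = (Nat.card Fˣ - a) * Nat.card Fˣ := by
  classical
  rw [Nat.card_eq_fintype_card] at ha
  obtain ⟨T, -, hT⟩ := Finset.exists_subset_card_eq (s := (Finset.univ : Finset Fˣ)) ha
  set g : Polynomial F := ∏ t ∈ T, (Polynomial.X - Polynomial.C (t : F)) with hg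
  have hdeg : g.natDegree = a := by
    rw [hg, Polynomial.natDegree_finsetProd_X_sub_C_eq_card, hT]
  refine ⟨fun p => g.eval (p.1 : F), ?_, ?_⟩
  · have hsum : (fun p : Fˣ × Fˣ => g.eval (p.1 : F)) =
        ∑ i ∈ Finset.range (a + 1), g.coeff i • evalVec F ((i : ℤ), (0 : ℤ)) := by
      funext p
      simp [Polynomial.eval_eq_sum_range, hdeg, evalVec]
    rw [hsum]
    refine Submodule.sum_mem _ fun i hi => Submodule.smul_mem _ _ (Submodule.subset_span ?_)
    exact ⟨_, hS i (Nat.lt_succ_iff.mp (Finset.mem_range.mp hi)), rfl⟩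
  · have hset : {p : Fˣ × Fˣ | g.eval (p.1 : F) ≠ 0} =
        ((Tᶜ ×ˢ Finset.univ : Finset (Fˣ × Fˣ)) : Set (Fˣ × Fˣ)) := by
      ext p
      simp only [hg, Polynomial.eval_prod, Polynomial.eval_sub, Polynomial.eval_X,
        Polynomial.eval_C, ne_eq, Finset.prod_eq_zero_iff, sub_eq_zero, Units.val_inj,
        Set.mem_ofPred_eq, Finset.coe_product, Finset.coe_compl, Finset.coe_univ, Set.mem_prod,
        Set.mem_compl_iff, Finset.mem_coe, Set.mem_univ, and_true, exists_eq_right']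
    rw [wt, hset, Set.ncard_coe_finset, Finset.card_product, Finset.card_compl, hT,
      Finset.card_univ, Nat.card_eq_fintype_card]

/-- The triangle `conv{(0,0),(a,0),(b,c)}` with `b + c ≤ a` lies in the simplex of size `a`. -/
theorem mem_simplex_of_mem_latticePts_triangle {a b c : ℕ} (habc : b + c ≤ a) {m : ℤ × ℤ}
    (hm : m ∈ latticePts (convexHull ℝ
      {((0 : ℝ), (0 : ℝ)), ((a : ℝ), (0 : ℝ)), ((b : ℝ), (c : ℝ))})) :
    0 ≤ m.1 ∧ 0 ≤ m.2 ∧ m.1 + m.2 ≤ a := by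
  have hconv : Convex ℝ {x : ℝ × ℝ | 0 ≤ x.1 ∧ 0 ≤ x.2 ∧ x.1 + x.2 ≤ a} := by
    intro x hx y hy s t hs ht hst
    obtain ⟨hx₁, hx₂, hx₃⟩ := hx
    obtain ⟨hy₁, hy₂, hy₃⟩ := hy
    simp only [Set.mem_ofPred_eq, Prod.fst_add, Prod.snd_add, Prod.smul_fst, Prod.smul_snd,
      smul_eq_mul]
    refine ⟨by positivity, by positivity, ?_⟩
    calc _ = s * (x.1 + x.2) + t * (y.1 + y.2) := by ring
      _ ≤ s * a + t * a := by gcongr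
      _ = a := by rw [← add_mul, hst, one_mul]
  have hsub : {((0 : ℝ), (0 : ℝ)), ((a : ℝ), (0 : ℝ)), ((b : ℝ), (c : ℝ))} ⊆
      {x : ℝ × ℝ | 0 ≤ x.1 ∧ 0 ≤ x.2 ∧ x.1 + x.2 ≤ a} := by
    have : (b : ℝ) + c ≤ a := by exact_mod_cast habc
    rintro x (rfl | rfl | rfl) <;> simp [this]
  obtain ⟨h₁, h₂, h₃⟩ := convexHull_min hsub hconv hm
  simp only [toR2] at h₁ h₂ h₃
  exact ⟨by exact_mod_cast h₁, by exact_mod_cast h₂, by exact_mod_cast h₃⟩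

/-- The base of the triangle `conv{(0,0),(a,0),v}` contains the lattice points `(i,0)`, `i ≤ a`. -/
theorem mem_latticePts_triangle {a i : ℕ} (hi : i ≤ a) (v : ℝ × ℝ) :
    ((i : ℤ), (0 : ℤ)) ∈ latticePts (convexHull ℝ {((0 : ℝ), (0 : ℝ)), ((a : ℝ), (0 : ℝ)), v}) := by
  have hseg : segment ℝ ((0 : ℝ), (0 : ℝ)) ((a : ℝ), (0 : ℝ)) ⊆
      convexHull ℝ {((0 : ℝ), (0 : ℝ)), ((a : ℝ), (0 : ℝ)), v} :=
    segment_subset_convexHull (by simp) (by simp)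
  refine hseg ?_
  rw [← Prod.image_mk_segment_left, segment_eq_Icc (Nat.cast_nonneg a)]
  exact ⟨i, ⟨Nat.cast_nonneg i, Nat.cast_le.mpr hi⟩, by simp [toR2]⟩

/-- Proposition 3.2: the minimum distance of the toric code of the triangle
`conv{(0,0),(a,0),(b,c)}` with `a ≥ b + c`. -/
theorem triangle_minDist (q : ℕ) (F : Type) [Field F] [Fintype F]
    (hF : Fintype.card F = q)
    (a b c : ℕ) (habc : b + c ≤ a) (hq : a + 1 < q)
    (P : Set (ℝ × ℝ))
    (hP : P = convexHull ℝ
      {((0 : ℝ), (0 : ℝ)), ((a : ℝ), (0 : ℝ)), ((b : ℝ), (c : ℝ))}) :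
    (minDist F (toricCode F (latticePts P)) : ℤ) =
      ((q : ℤ) - 1) ^ 2 - a * ((q : ℤ) - 1) := by
  classical
  subst hP
  have hunits : Nat.card Fˣ + 1 = q := by
    have := Fintype.card_units F
    rw [Nat.card_eq_fintype_card]
    omega
  have hlt : a < Nat.card Fˣ := by omega
  obtain ⟨w, hw, hwt⟩ := exists_mem_toricCode_wt_eq (F := F)
    (fun i hi => mem_latticePts_triangle hi ((b : ℝ), (c : ℝ))) hlt.le
  have hw0 : w ≠ 0 := by
    rintro rfl
    have : (Nat.card Fˣ - a) * Nat.card Fˣ = 0 := by rw [← hwt]; simp [wt]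
    rcases Nat.mul_eq_zero.mp this with h | h <;> omega
  have hmin : IsLeast {n | ∃ w ∈ toricCode F (latticePts (convexHull ℝ
      {((0 : ℝ), (0 : ℝ)), ((a : ℝ), (0 : ℝ)), ((b : ℝ), (c : ℝ))})), w ≠ 0 ∧ wt w = n}
      ((Nat.card Fˣ - a) * Nat.card Fˣ) := by
    refine ⟨⟨w, hw, hw0, hwt⟩, ?_⟩
    rintro _ ⟨u, hu, hu0, rfl⟩
    have := sq_le_wt_add_of_mem_toricCode
      (fun m hm => mem_simplex_of_mem_latticePts_triangle habc hm) hu hu0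
    rw [Nat.sub_mul, ← pow_two]
    omega
  rw [minDist, hmin.csInf_eq, ← hunits]
  push_cast [hlt.le]
  ring
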